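/- Let Ω, K ⊂ ℝⁿ be convex bodies with nonempty interior and r = r(Ω,K) the relative inradius. Then the function λ ↦ V_n(Ω ∼ λK)^{1/n} is concave on [0, r], where V_n denotes n-dimensional Lebesgue volume. -/

import Mathlib

open Pointwise MeasureTheory Set

noncomputable section

/-- The inner parallel body `Ω ∼ λK = {x : x + λK ⊆ Ω}`. -/
def innerPar {n : ℕ} (Ω K : Set (EuclideanSpace ℝ (Fin n))) (l : ℝ) :
    Set (EuclideanSpace ℝ (Fin n)) :=
  {x | ∀ y ∈ K, x + l • y ∈ Ω}

/-- The inradius of `Ω` relative to `K`. -/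
def inrad {n : ℕ} (Ω K : Set (EuclideanSpace ℝ (Fin n))) : ℝ :=
  sSup {l : ℝ | 0 ≤ l ∧ ∃ x, ∀ y ∈ K, x + l • y ∈ Ω}

/-- The anisotropic perimeter of `C` relative to `K`, realized as the anisotropic
Minkowski content `d/dt V_n(C + tK) |_{t=0⁺}`. -/
def aniPer {n : ℕ} (C K : Set (EuclideanSpace ℝ (Fin n))) : ℝ :=
  derivWithin (fun t : ℝ => (volume (C + t • K)).toReal) (Set.Ici (0:ℝ)) 0

/-- The mixed volume `V(C,…,C,K,…,K)` with `i` copies of `K`, extracted as the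
`i`-th Taylor coefficient (over `binom n i`) of `t ↦ V_n(C + tK)` at `t = 0⁺`. -/
def mixedVol {n : ℕ} (i : ℕ) (C K : Set (EuclideanSpace ℝ (Fin n))) : ℝ :=
  iteratedDerivWithin i (fun t : ℝ => (volume (C + t • K)).toReal) (Set.Ici (0:ℝ)) 0
    / (n.choose i * i.factorial)

open scoped ENNReal Topology
open Filter

theorem IsCompact.volume_add_le_volume {A B H : Set ℝ} (hA : IsCompact A) (hB : IsCompact B)
    (hA₀ : A.Nonempty) (hB₀ : B.Nonempty) (hH : ∀ x ∈ A, ∀ y ∈ B, x + y ∈ H) :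
    volume A + volume B ≤ volume H := by
  obtain ⟨p, hp, hpA⟩ := hA.exists_isGreatest hA₀
  obtain ⟨q, hq, hqB⟩ := hB.exists_isLeast hB₀
  have hAv : volume ((fun x => q + x) '' A) = volume A := by
    rw [image_add_left, measure_preimage_add]
  have hBv : volume ((fun x => p + x) '' B) = volume B := by
    rw [image_add_left, measure_preimage_add]
  have hdisj : AEDisjoint volume ((fun x => q + x) '' A) ((fun x => p + x) '' B) := by
    refine measure_mono_null (t := {p + q}) ?_ (measure_singleton _)
    rintro _ ⟨⟨x, hx, rfl⟩, y, hy, hxy⟩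
    have := hpA hx
    have := hqB hy
    simp only [mem_singleton_iff] at *
    linarith
  rw [← hAv, ← hBv, ← measure_union₀ (hB.image (by fun_prop)).measurableSet.nullMeasurableSet hdisj]
  refine measure_mono ?_
  rintro _ (⟨x, hx, rfl⟩ | ⟨y, hy, rfl⟩)
  · simpa [add_comm] using hH x hx q hq
  · exact hH p hp y hy

theorem MeasurableSet.volume_add_le_volume {A B H : Set ℝ} (hA : MeasurableSet A)
    (hB : MeasurableSet B) (hA₀ : A.Nonempty) (hB₀ : B.Nonempty)
    (hH : ∀ x ∈ A, ∀ y ∈ B, x + y ∈ H) : volume A + volume B ≤ volume H := by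
  obtain ⟨p, hp⟩ := hA₀
  obtain ⟨q, hq⟩ := hB₀
  rw [hA.measure_eq_iSup_isCompact, hB.measure_eq_iSup_isCompact]
  simp only [iSup_and']
  refine ENNReal.biSup_add_biSup_le' (p := fun K => K ⊆ A ∧ IsCompact K)
    (q := fun K => K ⊆ B ∧ IsCompact K) ⟨∅, by simp⟩ ⟨∅, by simp⟩ fun K hK L hL => ?_
  calc volume K + volume L ≤ volume (insert p K) + volume (insert q L) := by
        gcongr <;> exact subset_insert _ _
    _ ≤ volume H := (hK.2.insert p).volume_add_le_volume (hL.2.insert q) (insert_nonempty _ _)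
        (insert_nonempty _ _) fun x hx y hy =>
          hH x (insert_subset hp hK.1 hx) y (insert_subset hq hL.1 hy)

theorem MeasurableSet.volume_combo_le_volume {A B H : Set ℝ} {a b : ℝ} (ha : 0 < a) (hb : 0 < b)
    (hA : MeasurableSet A) (hB : MeasurableSet B) (hA₀ : A.Nonempty) (hB₀ : B.Nonempty)
    (hH : ∀ x ∈ A, ∀ y ∈ B, a * x + b * y ∈ H) :
    ENNReal.ofReal a * volume A + ENNReal.ofReal b * volume B ≤ volume H := by
  have := (hA.const_smul₀ a).volume_add_le_volume (hB.const_smul₀ b) hA₀.smul_set hB₀.smul_set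
    (H := H) (by rintro _ ⟨x, hx, rfl⟩ _ ⟨y, hy, rfl⟩; exact hH x hx y hy)
  simpa [Measure.addHaar_smul, abs_of_pos ha, abs_of_pos hb] using this

theorem lintegral_eq_lintegral_volume_lt {f : ℝ → ℝ≥0∞} (hf : Measurable f) (hf' : ∀ x, f x ≠ ∞) :
    ∫⁻ x, f x = ∫⁻ s in Ioi (0 : ℝ), volume {x | ENNReal.ofReal s < f x} := by
  have := lintegral_eq_lintegral_meas_lt (volume : Measure ℝ) (f := fun x => (f x).toReal)
    (Eventually.of_forall fun _ => ENNReal.toReal_nonneg) hf.ennreal_toReal.aemeasurable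
  simp only [ENNReal.ofReal_toReal (hf' _)] at this
  rw [this]
  refine setLIntegral_congr_fun measurableSet_Ioi fun s hs => ?_
  simp only [ENNReal.ofReal_lt_iff_lt_toReal (le_of_lt hs) (hf' _)]

theorem lintegral_combo_le_of_iSup_eq_one {f g h : ℝ → ℝ≥0∞} {a b : ℝ} (ha : 0 < a) (hb : 0 < b)
    (hab : a + b = 1) (hf : Measurable f) (hg : Measurable g) (hh : Measurable h)
    (hf₁ : ⨆ x, f x = 1) (hg₁ : ⨆ x, g x = 1)
    (H : ∀ x y, f x ^ a * g y ^ b ≤ h (a * x + b * y)) :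
    ENNReal.ofReal a * (∫⁻ x, f x) + ENNReal.ofReal b * (∫⁻ x, g x) ≤ ∫⁻ x, h x := by
  have hfle : ∀ x, f x ≤ 1 := fun x => hf₁ ▸ le_iSup f x
  have hgle : ∀ x, g x ≤ 1 := fun x => hg₁ ▸ le_iSup g x
  have htop : ∀ {u : ℝ≥0∞}, u ≤ 1 → u ≠ ∞ := fun hu => (hu.trans_lt ENNReal.one_lt_top).ne
  refine le_trans ?_ (lintegral_mono fun x => min_le_left (h x) 1)
  rw [lintegral_eq_lintegral_volume_lt hf fun x => htop (hfle x),
    lintegral_eq_lintegral_volume_lt hg fun x => htop (hgle x),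
    lintegral_eq_lintegral_volume_lt (hh.min measurable_const) fun x => htop (min_le_right _ _),
    ← lintegral_const_mul' _ _ ENNReal.ofReal_ne_top,
    ← lintegral_const_mul' _ _ ENNReal.ofReal_ne_top]
  refine (le_lintegral_add _ _).trans (setLIntegral_mono' measurableSet_Ioi fun s hs => ?_)
  rcases lt_or_ge s 1 with hs1 | hs1
  · have hs1' : ENNReal.ofReal s < 1 := by simpa using hs1
    refine (measurableSet_lt measurable_const hf).volume_combo_le_volume ha hb
      (measurableSet_lt measurable_const hg) (lt_iSup_iff.1 (hs1'.trans_eq hf₁.symm))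
      (lt_iSup_iff.1 (hs1'.trans_eq hg₁.symm)) fun x hx y hy => lt_min (lt_of_lt_of_le ?_ (H x y)) hs1'
    have hs0 : ENNReal.ofReal s ≠ 0 := by simpa using hs
    calc ENNReal.ofReal s = ENNReal.ofReal s ^ a * ENNReal.ofReal s ^ b := by
          rw [← ENNReal.rpow_add _ _ hs0 ENNReal.ofReal_ne_top, hab, ENNReal.rpow_one]
      _ < _ := ENNReal.mul_lt_mul (ENNReal.rpow_lt_rpow hx ha) (ENNReal.rpow_lt_rpow hy hb)
  · have hs1' : 1 ≤ ENNReal.ofReal s := by simpa using hs1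
    have hf0 : {x | ENNReal.ofReal s < f x} = ∅ :=
      eq_empty_of_forall_notMem fun x hx => ((hfle x).trans hs1').not_gt hx
    have hg0 : {x | ENNReal.ofReal s < g x} = ∅ :=
      eq_empty_of_forall_notMem fun x hx => ((hgle x).trans hs1').not_gt hx
    simp [hf0, hg0]

theorem ENNReal.geom_mean_le_arith_mean2_weighted {a b : ℝ} (ha : 0 < a) (hb : 0 < b)
    (hab : a + b = 1) (u v : ℝ≥0∞) :
    u ^ a * v ^ b ≤ ENNReal.ofReal a * u + ENNReal.ofReal b * v := by
  rcases eq_or_ne u ∞ with rfl | hu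
  · simp [ENNReal.mul_top, ha]
  rcases eq_or_ne v ∞ with rfl | hv
  · simp [ENNReal.mul_top, hb]
  lift u to NNReal using hu
  lift v to NNReal using hv
  lift a to NNReal using ha.le
  lift b to NNReal using hb.le
  have := NNReal.geom_mean_le_arith_mean2_weighted a b u v (by exact_mod_cast hab)
  rw [← ENNReal.coe_rpow_of_nonneg _ a.coe_nonneg, ← ENNReal.coe_rpow_of_nonneg _ b.coe_nonneg,
    ENNReal.ofReal_coe_nnreal, ENNReal.ofReal_coe_nnreal]
  exact_mod_cast this

theorem prekopa_leindler_real_of_bounded {f g h : ℝ → ℝ≥0∞} {a b : ℝ} (ha : 0 < a) (hb : 0 < b)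
    (hab : a + b = 1) (hf : Measurable f) (hg : Measurable g) (hh : Measurable h)
    (hf₁ : ⨆ x, f x ≠ ∞) (hg₁ : ⨆ x, g x ≠ ∞)
    (H : ∀ x y, f x ^ a * g y ^ b ≤ h (a * x + b * y)) :
    (∫⁻ x, f x) ^ a * (∫⁻ x, g x) ^ b ≤ ∫⁻ x, h x := by
  set A := ⨆ x, f x with hA
  set B := ⨆ x, g x with hB
  rcases eq_or_ne A 0 with hA0 | hA0
  · have : ∀ x, f x = 0 := by simpa [hA] using hA0
    simp [this, ha]
  rcases eq_or_ne B 0 with hB0 | hB0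
  · have : ∀ x, g x = 0 := by simpa [hB] using hB0
    simp [this, hb]
  set C := (A⁻¹) ^ a * (B⁻¹) ^ b with hC
  have hC0 : C ≠ 0 := by simp [hC, hf₁, hg₁, ha.not_gt, hb.not_gt]
  have hCt : C ≠ ∞ := ENNReal.mul_ne_top
    (ENNReal.rpow_ne_top_of_nonneg ha.le (by simpa)) (ENNReal.rpow_ne_top_of_nonneg hb.le (by simpa))
  have hmul : ∀ u v : ℝ≥0∞, (A⁻¹ * u) ^ a * (B⁻¹ * v) ^ b = C * (u ^ a * v ^ b) := fun u v => by
    rw [ENNReal.mul_rpow_of_nonneg _ _ ha.le, ENNReal.mul_rpow_of_nonneg _ _ hb.le, hC]; ring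
  have key := lintegral_combo_le_of_iSup_eq_one (f := fun x => A⁻¹ * f x) (g := fun x => B⁻¹ * g x)
    (h := fun x => C * h x) ha hb hab (by fun_prop) (by fun_prop) (by fun_prop)
    (by rw [← ENNReal.mul_iSup, ENNReal.inv_mul_cancel hA0 hf₁])
    (by rw [← ENNReal.mul_iSup, ENNReal.inv_mul_cancel hB0 hg₁])
    (fun x y => by rw [hmul]; gcongr; exact H x y)
  rw [lintegral_const_mul _ hf, lintegral_const_mul _ hg, lintegral_const_mul _ hh] at key
  have := (ENNReal.geom_mean_le_arith_mean2_weighted ha hb hab _ _).trans key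
  rwa [hmul, ENNReal.mul_le_mul_iff_right hC0 hCt] at this

theorem tendsto_lintegral_min_natCast {f : ℝ → ℝ≥0∞} (hf : Measurable f) :
    Tendsto (fun N : ℕ => ∫⁻ x, min (f x) N) atTop (𝓝 (∫⁻ x, f x)) := by
  refine lintegral_tendsto_of_tendsto_of_monotone (fun N => (hf.min measurable_const).aemeasurable)
    (Eventually.of_forall fun x m n hmn => by dsimp only; gcongr) (Eventually.of_forall fun x => ?_)
  simpa using (tendsto_const_nhds (x := f x)).min ENNReal.tendsto_nat_nhds_top

theorem prekopa_leindler_real {f g h : ℝ → ℝ≥0∞} {a b : ℝ} (ha : 0 < a) (hb : 0 < b)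
    (hab : a + b = 1) (hf : Measurable f) (hg : Measurable g) (hh : Measurable h)
    (H : ∀ x y, f x ^ a * g y ^ b ≤ h (a * x + b * y)) :
    (∫⁻ x, f x) ^ a * (∫⁻ x, g x) ^ b ≤ ∫⁻ x, h x := by
  rcases eq_or_ne (∫⁻ x, f x) 0 with hf0 | hf0
  · simp [hf0, ha]
  rcases eq_or_ne (∫⁻ x, g x) 0 with hg0 | hg0
  · simp [hg0, hb]
  refine le_of_tendsto' (ENNReal.Tendsto.mul
    ((ENNReal.continuous_rpow_const.tendsto _).comp (tendsto_lintegral_min_natCast hf))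
    (Or.inl (by simp [hf0, ha.not_gt]))
    ((ENNReal.continuous_rpow_const.tendsto _).comp (tendsto_lintegral_min_natCast hg))
    (Or.inl (by simp [hg0, hb.not_gt]))) fun N => ?_
  have hN : ∀ u : ℝ → ℝ≥0∞, ⨆ x, min (u x) (N : ℝ≥0∞) ≠ ∞ := fun u =>
    ((iSup_le fun x => min_le_right _ _).trans_lt (ENNReal.natCast_lt_top N)).ne
  refine prekopa_leindler_real_of_bounded ha hb hab (hf.min measurable_const)
    (hg.min measurable_const) hh (hN f) (hN g) fun x y => le_trans ?_ (H x y)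
  gcongr <;> exact min_le_left _ _

theorem lintegral_fin_succ {n : ℕ} {f : (Fin (n + 1) → ℝ) → ℝ≥0∞} (hf : Measurable f) :
    ∫⁻ x, f x = ∫⁻ s : ℝ, ∫⁻ x : Fin n → ℝ, f (Fin.cons s x) := by
  have e := (volume_preserving_piFinSuccAbove (fun _ : Fin (n + 1) => ℝ) 0).symm
  rw [← e.lintegral_comp hf, Measure.volume_eq_prod, lintegral_prod]
  · simp [MeasurableEquiv.piFinSuccAbove, Fin.insertNthEquiv, Fin.insertNth_zero']
  · exact (hf.comp (MeasurableEquiv.measurable _)).aemeasurable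

theorem measurable_fin_cons {n : ℕ} :
    Measurable fun p : ℝ × (Fin n → ℝ) => (Fin.cons p.1 p.2 : Fin (n + 1) → ℝ) := by
  simpa [MeasurableEquiv.piFinSuccAbove, Fin.insertNthEquiv, Fin.insertNth_zero'] using
    (MeasurableEquiv.piFinSuccAbove (fun _ : Fin (n + 1) => ℝ) 0).symm.measurable

/-- The **Prékopa–Leindler inequality** on `ℝⁿ`. -/
theorem prekopa_leindler {n : ℕ} {f g h : (Fin n → ℝ) → ℝ≥0∞} {a b : ℝ} (ha : 0 < a) (hb : 0 < b)
    (hab : a + b = 1) (hf : Measurable f) (hg : Measurable g) (hh : Measurable h)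
    (H : ∀ x y, f x ^ a * g y ^ b ≤ h (a • x + b • y)) :
    (∫⁻ x, f x) ^ a * (∫⁻ x, g x) ^ b ≤ ∫⁻ x, h x := by
  induction n with
  | zero =>
    have hv : volume (univ : Set (Fin 0 → ℝ)) = 1 := by
      rw [volume_pi, Measure.pi_univ]; simp
    simp only [lintegral_unique, hv, mul_one]
    convert H default default
  | succ n ih =>
    rw [lintegral_fin_succ hf, lintegral_fin_succ hg, lintegral_fin_succ hh]
    refine prekopa_leindler_real ha hb hab
      (hf.comp measurable_fin_cons).lintegral_prod_right'
      (hg.comp measurable_fin_cons).lintegral_prod_right'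
      (hh.comp measurable_fin_cons).lintegral_prod_right' fun s t =>
        ih (hf.comp (measurable_fin_cons.comp measurable_prodMk_left))
          (hg.comp (measurable_fin_cons.comp measurable_prodMk_left))
          (hh.comp (measurable_fin_cons.comp measurable_prodMk_left)) fun x y => ?_
    convert H (Fin.cons s x) (Fin.cons t y) using 2
    ext i
    refine Fin.cases ?_ (fun j => ?_) i <;> simp

/-- The multiplicative form of the **Brunn–Minkowski inequality**. -/
theorem volume_rpow_mul_volume_rpow_le {n : ℕ} {A B C : Set (EuclideanSpace ℝ (Fin n))} {a b : ℝ}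
    (ha : 0 < a) (hb : 0 < b) (hab : a + b = 1) (hA : MeasurableSet A) (hB : MeasurableSet B)
    (hC : MeasurableSet C) (H : ∀ x ∈ A, ∀ y ∈ B, a • x + b • y ∈ C) :
    volume A ^ a * volume B ^ b ≤ volume C := by
  have e := PiLp.volume_preserving_toLp (Fin n)
  have hA' := hA.preimage e.measurable
  have hB' := hB.preimage e.measurable
  have hC' := hC.preimage e.measurable
  rw [← e.measure_preimage hA.nullMeasurableSet, ← e.measure_preimage hB.nullMeasurableSet,
    ← e.measure_preimage hC.nullMeasurableSet, ← lintegral_indicator_one hA',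
    ← lintegral_indicator_one hB', ← lintegral_indicator_one hC']
  refine prekopa_leindler ha hb hab (measurable_one.indicator hA') (measurable_one.indicator hB')
    (measurable_one.indicator hC') fun x y => ?_
  by_cases hx : WithLp.toLp 2 x ∈ A
  · by_cases hy : WithLp.toLp 2 y ∈ B
    · have := H _ hx _ hy
      simp [indicator, hx, hy, this]
    · simp [indicator, hy, hb]
  · simp [indicator, hx, ha]

theorem mul_volume_rpow_le {n : ℕ} (hn : n ≠ 0) {B C : Set (EuclideanSpace ℝ (Fin n))}
    {b : ℝ} (hb : 0 < b) (hC : volume C ≠ ∞) (v : EuclideanSpace ℝ (Fin n))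
    (H : ∀ y ∈ B, v + b • y ∈ C) :
    b * (volume B).toReal ^ ((1 : ℝ) / n) ≤ (volume C).toReal ^ ((1 : ℝ) / n) := by
  have h : (volume (v +ᵥ b • B)).toReal ≤ (volume C).toReal := by
    refine ENNReal.toReal_mono hC (measure_mono ?_)
    rintro _ ⟨_, ⟨y, hy, rfl⟩, rfl⟩
    exact H y hy
  rw [measure_vadd, Measure.addHaar_smul, finrank_euclideanSpace_fin, abs_of_pos (pow_pos hb n),
    ENNReal.toReal_mul, ENNReal.toReal_ofReal (pow_pos hb n).le] at h
  calc b * (volume B).toReal ^ ((1 : ℝ) / n)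
      = (b ^ n * (volume B).toReal) ^ ((1 : ℝ) / n) := by
        rw [Real.mul_rpow (by positivity) (by positivity), one_div, Real.pow_rpow_inv_natCast hb.le hn]
    _ ≤ _ := by gcongr

/-- The **Brunn–Minkowski inequality**. -/
theorem brunn_minkowski {n : ℕ} (hn : n ≠ 0) {A B C : Set (EuclideanSpace ℝ (Fin n))} {a b : ℝ}
    (ha : 0 < a) (hb : 0 < b) (hA : MeasurableSet A) (hB : MeasurableSet B) (hC : MeasurableSet C)
    (hA₀ : A.Nonempty) (hB₀ : B.Nonempty) (hC₁ : volume C ≠ ∞)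
    (H : ∀ x ∈ A, ∀ y ∈ B, a • x + b • y ∈ C) :
    a * (volume A).toReal ^ ((1 : ℝ) / n) + b * (volume B).toReal ^ ((1 : ℝ) / n) ≤
      (volume C).toReal ^ ((1 : ℝ) / n) := by
  have hn' : (1 : ℝ) / n ≠ 0 := by positivity
  rcases eq_or_ne (volume A).toReal 0 with hA0 | hA0
  · obtain ⟨x, hx⟩ := hA₀
    simpa [hA0, Real.zero_rpow, hn] using
      mul_volume_rpow_le hn hb hC₁ (a • x) fun y hy => H x hx y hy
  rcases eq_or_ne (volume B).toReal 0 with hB0 | hB0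
  · obtain ⟨y, hy⟩ := hB₀
    simpa [hB0, Real.zero_rpow, hn] using
      mul_volume_rpow_le hn ha hC₁ (b • y) fun x hx => by rw [add_comm]; exact H x hx y hy
  have hvA : 0 < (volume A).toReal := lt_of_le_of_ne ENNReal.toReal_nonneg hA0.symm
  have hvB : 0 < (volume B).toReal := lt_of_le_of_ne ENNReal.toReal_nonneg hB0.symm
  have smul_volume : ∀ {u : ℝ} (S : Set (EuclideanSpace ℝ (Fin n))), 0 < u →
      volume (u⁻¹ • S) = ENNReal.ofReal ((u ^ n)⁻¹) * volume S := fun {u} S hu => by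
    rw [Measure.addHaar_smul, finrank_euclideanSpace_fin, inv_pow, abs_of_pos (by positivity)]
  have normalize : ∀ {S : Set (EuclideanSpace ℝ (Fin n))}, 0 < (volume S).toReal →
      volume (((volume S).toReal ^ ((1 : ℝ) / n))⁻¹ • S) = 1 := fun {S} hS => by
    rw [smul_volume S (by positivity), one_div, Real.rpow_inv_natCast_pow hS.le hn,
      ENNReal.ofReal_inv_of_pos hS, ENNReal.ofReal_toReal (ENNReal.toReal_pos_iff.1 hS).2.ne,
      ENNReal.inv_mul_cancel (ENNReal.toReal_pos_iff.1 hS).1.ne'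
        (ENNReal.toReal_pos_iff.1 hS).2.ne]
  have hA1 := normalize hvA
  have hB1 := normalize hvB
  set α := (volume A).toReal ^ ((1 : ℝ) / n)
  set β := (volume B).toReal ^ ((1 : ℝ) / n)
  have hα : 0 < α := by positivity
  have hβ : 0 < β := by positivity
  set s := a * α + b * β
  have hs : 0 < s := by positivity
  have key := volume_rpow_mul_volume_rpow_le (A := α⁻¹ • A) (B := β⁻¹ • B) (C := s⁻¹ • C)
    (a := a * α / s) (b := b * β / s) (by positivity) (by positivity)
    (by rw [← add_div, div_self hs.ne']) (hA.const_smul₀ _) (hB.const_smul₀ _) (hC.const_smul₀ _) (by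
      rintro _ ⟨x, hx, rfl⟩ _ ⟨y, hy, rfl⟩
      refine ⟨_, H x hx y hy, ?_⟩
      simp only [smul_add, smul_smul]
      congr 2 <;> field_simp)
  rw [hA1, hB1, ENNReal.one_rpow, ENNReal.one_rpow, one_mul, smul_volume C hs] at key
  have key' := ENNReal.toReal_mono (ENNReal.mul_ne_top ENNReal.ofReal_ne_top hC₁) key
  rw [ENNReal.toReal_one, ENNReal.toReal_mul, ENNReal.toReal_ofReal (by positivity),
    ← div_eq_inv_mul, one_le_div (by positivity)] at key'
  rw [one_div]
  exact Real.le_rpow_inv_iff_of_pos hs.le (by positivity) (by positivity) |>.2 (by simpa using key')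

section InnerParallel

variable {n : ℕ} {Ω K : Set (EuclideanSpace ℝ (Fin n))}

theorem isCompact_innerPar (hΩ : IsCompact Ω) (hK : K.Nonempty) (l : ℝ) :
    IsCompact (innerPar Ω K l) := by
  obtain ⟨k, hk⟩ := hK
  have hclosed : IsClosed (innerPar Ω K l) := by
    simp only [innerPar, ofPred_forall]
    exact isClosed_biInter fun y _ => hΩ.isClosed.preimage (by fun_prop)
  refine (hΩ.image (f := fun z => z - l • k) (by fun_prop)).of_isClosed_subset hclosed
    fun x hx => ⟨x + l • k, hx k hk, by simp⟩

theorem smul_add_smul_mem_innerPar (hΩ : Convex ℝ Ω) {a b l m : ℝ} (ha : 0 ≤ a) (hb : 0 ≤ b)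
    (hab : a + b = 1) {x y : EuclideanSpace ℝ (Fin n)} (hx : x ∈ innerPar Ω K l)
    (hy : y ∈ innerPar Ω K m) : a • x + b • y ∈ innerPar Ω K (a • l + b • m) := by
  intro z hz
  convert hΩ (hx z hz) (hy z hz) ha hb hab using 1
  simp only [smul_eq_mul]
  module

theorem innerPar_nonempty_of_le (hK : Convex ℝ K) (hK₀ : K.Nonempty) {l m : ℝ} (hl : 0 ≤ l)
    (hlm : l ≤ m) (hm : (innerPar Ω K m).Nonempty) : (innerPar Ω K l).Nonempty := by
  obtain ⟨x, hx⟩ := hm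
  obtain ⟨k, hk⟩ := hK₀
  rcases hlm.eq_or_lt with rfl | hlm'
  · exact ⟨x, hx⟩
  have hm0 : 0 < m := hl.trans_lt hlm'
  refine ⟨x + (m - l) • k, fun y hy => ?_⟩
  convert hx _ (hK hk hy (a := (m - l) / m) (b := l / m) (div_nonneg (by linarith) hm0.le)
    (div_nonneg hl hm0.le) (by field_simp; ring)) using 1
  rw [smul_add, smul_smul, smul_smul, mul_div_cancel₀ _ hm0.ne', mul_div_cancel₀ _ hm0.ne',
    add_assoc]

/-- The supremum defining the relative inradius is attained. -/
theorem innerPar_inrad_nonempty (hΩ : IsCompact Ω) (hΩ₀ : Ω.Nonempty) (hK : K.Nontrivial) :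
    (innerPar Ω K (inrad Ω K)).Nonempty := by
  obtain ⟨k, hk, k', hk', hne⟩ := hK
  obtain ⟨ω, hω⟩ := hΩ₀
  set P : Set (ℝ × EuclideanSpace ℝ (Fin n)) := {p | 0 ≤ p.1 ∧ ∀ y ∈ K, p.2 + p.1 • y ∈ Ω}
  have hd : 0 < ‖k - k'‖ := norm_pos_iff.2 (sub_ne_zero.2 hne)
  have hclosed : IsClosed P := by
    simp only [P, ofPred_and, ofPred_forall]
    exact (isClosed_le continuous_const continuous_fst).inter
      (isClosed_biInter fun y _ => hΩ.isClosed.preimage (by fun_prop))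
  have hP : IsCompact P := by
    refine ((isCompact_Icc (a := (0 : ℝ)) (b := Metric.diam Ω / ‖k - k'‖)).prod hΩ |>.image
      (f := fun p : ℝ × EuclideanSpace ℝ (Fin n) => (p.1, p.2 - p.1 • k))
      (by fun_prop)).of_isClosed_subset hclosed ?_
    rintro ⟨l, x⟩ ⟨hl, hx⟩
    refine ⟨(l, x + l • k), ⟨⟨hl, ?_⟩, hx k hk⟩, by simp⟩
    have := Metric.dist_le_diam_of_mem hΩ.isBounded (hx k hk) (hx k' hk')
    rw [dist_add_left, dist_eq_norm, ← smul_sub, norm_smul, Real.norm_of_nonneg hl] at this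
    exact (le_div_iff₀ hd).2 this
  have hS : {l : ℝ | 0 ≤ l ∧ ∃ x, ∀ y ∈ K, x + l • y ∈ Ω} = Prod.fst '' P := by
    ext l
    simp [P]
  have := (hP.image continuous_fst).sSup_mem ⟨0, (0, ω), ⟨le_rfl, fun y _ => by simpa using hω⟩, rfl⟩
  rw [← hS] at this
  exact this.2

end InnerParallel

/-- `λ ↦ V_n(Ω ∼ λK)^{1/n}` is concave on `[0, r(Ω,K)]`. -/
theorem stmt6 {n : ℕ} (hn : 1 ≤ n) (Ω K : Set (EuclideanSpace ℝ (Fin n)))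
    (hΩc : IsCompact Ω) (hΩconv : Convex ℝ Ω) (hΩint : (interior Ω).Nonempty)
    (hKc : IsCompact K) (hKconv : Convex ℝ K) (hKint : (interior K).Nonempty) :
    ConcaveOn ℝ (Set.Icc 0 (inrad Ω K))
      (fun l => (volume (innerPar Ω K l)).toReal ^ ((1:ℝ) / n)) := by
  have hK₀ : K.Nonempty := hKint.mono interior_subset
  have : Nonempty (Fin n) := ⟨⟨0, hn⟩⟩
  have (x : EuclideanSpace ℝ (Fin n)) : (𝓝[≠] x).NeBot := Module.punctured_nhds_neBot ℝ _ x
  have hK : K.Nontrivial := by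
    obtain ⟨x, hx⟩ := hKint
    exact (infinite_of_mem_nhds x (mem_interior_iff_mem_nhds.1 hx)).nontrivial
  have hne : ∀ l ∈ Set.Icc 0 (inrad Ω K), (innerPar Ω K l).Nonempty := fun l hl =>
    innerPar_nonempty_of_le hKconv hK₀ hl.1 hl.2
      (innerPar_inrad_nonempty hΩc (hΩint.mono interior_subset) hK)
  have hc := isCompact_innerPar hΩc hK₀
  refine concaveOn_iff_forall_pos.2 ⟨convex_Icc _ _, fun l hl m hm a b ha hb hab => ?_⟩
  exact brunn_minkowski (by lia) ha hb (hc l).measurableSet (hc m).measurableSet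
    (hc _).measurableSet (hne l hl) (hne m hm) (hc _).measure_lt_top.ne fun x hx y hy =>
      smul_add_smul_mem_innerPar hΩconv ha.le hb.le hab hx hy
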